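/- arXiv:1804.03171 — 2 statements merged into one kernel-verified Lean document; each statement's English description precedes it below -/
import Mathlib

section
/- Consider the inverse-problem setting with exact coefficient c satisfying c(x) ≥ 0 on Ω and f satisfying condition (7). Let c⁰ be the initial approximation defined by (16), let u⁰ be the sufficiently smooth solution of the direct problem with coefficient c⁰, and let c¹ be defined from u⁰ by the iteration formula. Then c¹(x) ≤ c⁰(x) for all x ∈ Ω. -/
noncomputable section

/-- The plane `ℝ²`. -/
abbrev E2 : Type := EuclideanSpace ℝ (Fin 2)

/-- The elliptic operator `(A v)(x) = - div (k(x) grad v(x))`. -/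
def ellOp (k : E2 → ℝ) (v : E2 → ℝ) (x : E2) : ℝ :=
  - ∑ i : Fin 2, fderiv ℝ (fun y => k y • gradient v y) x (EuclideanSpace.single i 1) i

/-- `u` solves the direct problem on `Ω × (0,T]` with diffusion coefficient `k`,
Robin boundary coefficient `μ`, reaction coefficient `c` and right-hand side `f`:
the parabolic equation, the homogeneous initial condition and the homogeneous
Robin (third-kind) boundary condition with respect to any outward unit normal. -/
structure IsDirectSolution (Ω : Set E2) (T : ℝ) (k μ : E2 → ℝ)
    (c : E2 → ℝ) (f : E2 → ℝ → ℝ) (u : E2 → ℝ → ℝ) : Prop where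
  pde : ∀ x ∈ Ω, ∀ t : ℝ, 0 < t → t ≤ T →
    deriv (u x) t + ellOp k (fun y => u y t) x + c x * u x t = f x t
  ic : ∀ x ∈ Ω, u x 0 = 0
  robin : ∀ x ∈ frontier Ω, ∀ ν : E2, ‖ν‖ = 1 →
    (∀ y ∈ closure Ω, (inner ℝ ν (y - x) : ℝ) ≤ 0) →
    ∀ t : ℝ, 0 < t → t ≤ T →
      k x * fderiv ℝ (fun y => u y t) x ν + μ x * u x t = 0

/-- Nondivergence form of the operator. -/
theorem ellOp_eq (k v : E2 → ℝ) (x : E2) (hk : DifferentiableAt ℝ k x) (hv : ContDiff ℝ 2 v) :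
    ellOp k v x = - ∑ i : Fin 2, (k x * fderiv ℝ (fderiv ℝ v) x (EuclideanSpace.single i 1)
        (EuclideanSpace.single i 1)
      + fderiv ℝ k x (EuclideanSpace.single i 1) * fderiv ℝ v x (EuclideanSpace.single i 1)) := by
  have hd : DifferentiableAt ℝ (fderiv ℝ v) x :=
    ((hv.fderiv_right (m := 1) (by norm_num)).differentiable (by norm_num)) x
  let J : (E2 →L[ℝ] ℝ) →L[ℝ] E2 :=
    { toFun := fun ℓ => (InnerProductSpace.toDual ℝ E2).symm ℓ
      map_add' := fun a b => map_add _ a b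
      map_smul' := fun a b => by
        rw [LinearIsometryEquiv.map_smulₛₗ]
        simp
      cont := (InnerProductSpace.toDual ℝ E2).symm.continuous }
  have hJ : ∀ ℓ, J ℓ = (InnerProductSpace.toDual ℝ E2).symm ℓ := fun _ => rfl
  have hg : HasFDerivAt (gradient v) (J.comp (fderiv ℝ (fderiv ℝ v) x)) x :=
    (J.hasFDerivAt (x := fderiv ℝ v x)).comp x hd.hasFDerivAt
  have hco : ∀ (ℓ : E2 →L[ℝ] ℝ) (i : Fin 2),
      ((InnerProductSpace.toDual ℝ E2).symm ℓ) i = ℓ (EuclideanSpace.single i 1) := by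
    intro ℓ i
    have := InnerProductSpace.toDual_symm_apply (𝕜 := ℝ) (x := EuclideanSpace.single i (1:ℝ)) (y := ℓ)
    rw [← this, EuclideanSpace.inner_single_right]
    simp
  have hm := hk.hasFDerivAt.smul hg
  unfold ellOp
  congr 1
  refine Finset.sum_congr rfl fun i _ => ?_
  have h2 : fderiv ℝ (fun y => k y • gradient v y) x = _ := hm.fderiv
  rw [h2]
  have h3 : gradient v x = (InnerProductSpace.toDual ℝ E2).symm (fderiv ℝ v x) := rfl
  simp [h3, hJ, hco]

theorem ellOp_lin (k v w : E2 → ℝ) (a : ℝ) (x : E2) (hk : DifferentiableAt ℝ k x)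
    (hv : ContDiff ℝ 2 v) (hw : ContDiff ℝ 2 w) :
    ellOp k (fun y => v y + a * w y) x = ellOp k v x + a * ellOp k w x := by
  have h1 : ∀ y, fderiv ℝ (fun y => v y + a * w y) y = fderiv ℝ v y + a • fderiv ℝ w y := by
    intro y
    have a1 := (hv.differentiable (by norm_num)) y
    have a2 := (hw.differentiable (by norm_num)) y
    exact (a1.hasFDerivAt.add (a2.hasFDerivAt.const_mul a)).fderiv
  have h2 : fderiv ℝ (fderiv ℝ (fun y => v y + a * w y)) x
      = fderiv ℝ (fderiv ℝ v) x + a • fderiv ℝ (fderiv ℝ w) x := by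
    rw [funext h1]
    have a1 := ((hv.fderiv_right (m := 1) (by norm_num)).differentiable (by norm_num)) x
    have a2 := ((hw.fderiv_right (m := 1) (by norm_num)).differentiable (by norm_num)) x
    exact (a1.hasFDerivAt.add (a2.hasFDerivAt.const_smul a)).fderiv
  rw [ellOp_eq k _ x hk (hv.add (contDiff_const.mul hw)), ellOp_eq k v x hk hv,
    ellOp_eq k w x hk hw, h1, h2]
  simp only [Fin.sum_univ_two, add_apply, smul_apply,
    smul_eq_mul]
  ring

theorem second_deriv_nonneg {g : ℝ → ℝ} {g' : ℝ → ℝ} {g2 : ℝ} (hg : ∀ s, HasDerivAt g (g' s) s)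
    (hg2 : HasDerivAt g' g2 0) (hmin : IsLocalMin g 0) : 0 ≤ g2 := by
  by_contra hneg
  push Not at hneg
  have h0 : g' 0 = 0 := hmin.hasDerivAt_eq_zero (hg 0)
  have e1 : ∀ᶠ s in nhdsWithin (0:ℝ) (Set.Ioi 0), slope g' 0 s < 0 := by
    have := hasDerivAt_iff_tendsto_slope.1 hg2
    have h3 := this.mono_left (nhdsWithin_mono (0:ℝ) (s := Set.Ioi 0) (fun y (hy : 0 < y) => by
      simpa using hy.ne'))
    exact h3.eventually (gt_mem_nhds hneg)
  have e2 : ∀ᶠ s in nhdsWithin (0:ℝ) (Set.Ioi 0), g 0 ≤ g s := hmin.filter_mono nhdsWithin_le_nhds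
  obtain ⟨δ, hδ, hsub⟩ := mem_nhdsGT_iff_exists_Ioo_subset.1 (e1.and e2)
  have hδ' : (0:ℝ) < δ := hδ
  have hm : δ / 2 ∈ Set.Ioo 0 δ := ⟨by linarith, by linarith⟩
  obtain ⟨ξ, hξ, hξe⟩ := exists_hasDerivAt_eq_slope g g' (show (0:ℝ) < δ/2 by linarith)
    (fun y _ => (hg y).continuousAt.continuousWithinAt) (fun y _ => hg y)
  have hξ1 := (hsub ⟨hξ.1, by linarith [hξ.2]⟩).1
  have hge : g 0 ≤ g (δ/2) := (hsub hm).2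
  have hξn : g' ξ < 0 := by
    simp only [slope_def_field, h0, sub_zero] at hξ1
    rcases div_neg_iff.1 hξ1 with h | h
    · linarith [h.2, hξ.1]
    · exact h.1
  have : 0 ≤ (g (δ/2) - g 0) / (δ/2 - 0) := div_nonneg (by linarith) (by linarith)
  linarith

theorem ellOp_nonpos_of_min (k v : E2 → ℝ) (x : E2) (hk : DifferentiableAt ℝ k x)
    (hk0 : 0 ≤ k x) (hv : ContDiff ℝ 2 v) (hmin : IsLocalMin v x) : ellOp k v x ≤ 0 := by
  rw [ellOp_eq k v x hk hv, hmin.fderiv_eq_zero]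
  have key : ∀ e : E2, 0 ≤ fderiv ℝ (fderiv ℝ v) x e e := by
    intro e
    have hl : ∀ s : ℝ, HasDerivAt (fun s : ℝ => x + s • e) e s := by
      intro s
      simpa using ((hasDerivAt_id s).smul_const e).const_add x
    have hd1 : ∀ s : ℝ, HasDerivAt (fun s : ℝ => v (x + s • e)) (fderiv ℝ v (x + s • e) e) s := by
      intro s
      exact ((hv.differentiable (by norm_num)) (x + s • e)).hasFDerivAt.comp_hasDerivAt s (hl s)
    have hd2 : HasDerivAt (fun s : ℝ => fderiv ℝ v (x + s • e) e)
        (fderiv ℝ (fderiv ℝ v) x e e) 0 := by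
      have a := ((hv.fderiv_right (m := 1) (by norm_num)).differentiable (by norm_num))
        (x + (0:ℝ) • e)
      have b := a.hasFDerivAt.comp_hasDerivAt (0:ℝ) (hl 0)
      have c := b.clm_apply (hasDerivAt_const (0:ℝ) e)
      simpa using c
    refine second_deriv_nonneg hd1 hd2 ?_
    have hc : Filter.Tendsto (fun s : ℝ => x + s • e) (nhds 0) (nhds x) := by
      have := (hl 0).continuousAt.tendsto
      simpa using this
    have := hc.eventually hmin
    simpa [IsLocalMin, IsMinFilter] using this
  simp only [zero_apply, mul_zero, add_zero, Fin.sum_univ_two]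
  have a := mul_nonneg hk0 (key (EuclideanSpace.single 0 1))
  have b := mul_nonneg hk0 (key (EuclideanSpace.single 1 1))
  linarith

theorem ellOp_bdd (Ω : Set E2) (hΩo : IsOpen Ω) (hΩb : Bornology.IsBounded Ω)
    (hΩconv : Convex ℝ Ω) (hne : Ω.Nonempty) (k : E2 → ℝ) (hkC1 : ContDiffOn ℝ 1 k (closure Ω))
    (h : E2 → ℝ) (hh : ContDiff ℝ 2 h) : ∃ C : ℝ, ∀ x ∈ Ω, |ellOp k h x| ≤ C := by
  have hud : UniqueDiffOn ℝ (closure Ω) := by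
    refine uniqueDiffOn_convex hΩconv.closure ?_
    exact hne.mono (interior_maximal subset_closure hΩo)
  have hcf : ContinuousOn (fderivWithin ℝ k (closure Ω)) (closure Ω) :=
    hkC1.continuousOn_fderivWithin hud (by norm_num)
  have c1 : Continuous (fderiv ℝ h) := hh.continuous_fderiv (by norm_num)
  have c2 : Continuous (fderiv ℝ (fderiv ℝ h)) :=
    (hh.fderiv_right (m := 1) (by norm_num)).continuous_fderiv (by norm_num)
  have hkc := hkC1.continuousOn
  have hcont : ContinuousOn (fun x => - ∑ i : Fin 2, (k x * fderiv ℝ (fderiv ℝ h) x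
        (EuclideanSpace.single i 1) (EuclideanSpace.single i 1)
      + fderivWithin ℝ k (closure Ω) x (EuclideanSpace.single i 1)
        * fderiv ℝ h x (EuclideanSpace.single i 1))) (closure Ω) := by
    refine ContinuousOn.neg (continuousOn_finsetSum _ fun i _ => ?_)
    refine ContinuousOn.add (hkc.mul ?_) (ContinuousOn.mul ?_ ?_)
    · exact Continuous.continuousOn (by fun_prop)
    · exact hcf.clm_apply continuousOn_const
    · exact Continuous.continuousOn (by fun_prop)
  have hcomp : IsCompact (closure Ω) := hΩb.isCompact_closure
  obtain ⟨C, hC⟩ := hcomp.exists_bound_of_continuousOn hcont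
  refine ⟨C, fun x hx => ?_⟩
  have hn : closure Ω ∈ nhds x := Filter.mem_of_superset (hΩo.mem_nhds hx) subset_closure
  have hkd : DifferentiableAt ℝ k x :=
    (hkC1.differentiableOn (by norm_num)).differentiableAt hn
  have := hC x (subset_closure hx)
  rw [fderivWithin_of_mem_nhds hn, Real.norm_eq_abs, ← ellOp_eq k h x hkd hh] at this
  exact this

theorem exists_normal (Ω : Set E2) (hΩo : IsOpen Ω) (hΩconv : Convex ℝ Ω) (x : E2)
    (hne : Ω.Nonempty) (hx : x ∉ Ω) :
    ∃ ν : E2, ‖ν‖ = 1 ∧ ∀ y ∈ closure Ω, (inner ℝ ν (y - x) : ℝ) ≤ 0 := by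
  obtain ⟨ℓ, hℓ⟩ := geometric_hahn_banach_open_point hΩconv hΩo hx
  set w := (InnerProductSpace.toDual ℝ E2).symm ℓ with hw
  have hwi : ∀ y, inner ℝ w y = ℓ y := fun y => InnerProductSpace.toDual_symm_apply
  have hw0 : w ≠ 0 := by
    intro h0
    obtain ⟨y, hy⟩ := hne
    have := hℓ y hy
    rw [← hwi, ← hwi, h0] at this
    simp at this
  refine ⟨‖w‖⁻¹ • w, norm_smul_inv_norm hw0, fun y hy => ?_⟩
  have hle : ℓ y ≤ ℓ x := by
    have : closure Ω ⊆ {y | ℓ y ≤ ℓ x} :=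
      closure_minimal (fun z hz => (hℓ z hz).le) (isClosed_le ℓ.continuous continuous_const)
    exact this hy
  rw [inner_smul_left, hwi, map_sub]
  exact mul_nonpos_of_nonneg_of_nonpos (by simp) (by linarith)

theorem left_deriv_sign {g : ℝ → ℝ} {a t : ℝ} (hat : a < t) (hd : DifferentiableAt ℝ g t)
    (h : ∀ s, a ≤ s → s ≤ t → g t ≤ g s) : deriv g t ≤ 0 := by
  have := hd.hasDerivAt
  have h3 := (hasDerivAt_iff_tendsto_slope.1 this).mono_left
    (nhdsWithin_mono t (s := Set.Iio t) (fun y (hy : y < t) => by simpa using hy.ne))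
  refine le_of_tendsto h3 ?_
  filter_upwards [Ioo_mem_nhdsLT hat] with s hs
  rw [slope_def_field]
  exact div_nonpos_of_nonneg_of_nonpos (by linarith [h s hs.1.le hs.2.le]) (by linarith [hs.2])

theorem strict_max (Ω : Set E2) (hΩo : IsOpen Ω) (hΩb : Bornology.IsBounded Ω)
    (hΩconv : Convex ℝ Ω) (hne : Ω.Nonempty) (T : ℝ) (hT : 0 < T)
    (k μ c : E2 → ℝ) (hk : ∀ x ∈ closure Ω, 0 < k x) (hkd : ∀ x ∈ Ω, DifferentiableAt ℝ k x)
    (hμ : ∀ x ∈ frontier Ω, 0 ≤ μ x) (hc : ∀ x ∈ Ω, 0 ≤ c x)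
    (z : E2 → ℝ → ℝ) (hzc : Continuous (Function.uncurry z))
    (hz2 : ∀ t, ContDiff ℝ 2 (fun y => z y t)) (hzt : ∀ x t, DifferentiableAt ℝ (z x) t)
    (hpde : ∀ x ∈ Ω, ∀ t : ℝ, 0 < t → t ≤ T →
      0 < deriv (z x) t + ellOp k (fun y => z y t) x + c x * z x t)
    (hic : ∀ x ∈ closure Ω, 0 ≤ z x 0)
    (hrob : ∀ x ∈ frontier Ω, ∀ ν : E2, ‖ν‖ = 1 →
      (∀ y ∈ closure Ω, (inner ℝ ν (y - x) : ℝ) ≤ 0) → ∀ t : ℝ, 0 < t → t ≤ T →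
      0 < k x * fderiv ℝ (fun y => z y t) x ν + μ x * z x t) :
    ∀ x ∈ closure Ω, ∀ t, 0 ≤ t → t ≤ T → 0 ≤ z x t := by
  have hcomp : IsCompact (closure Ω ×ˢ Set.Icc 0 T) := hΩb.isCompact_closure.prod isCompact_Icc
  obtain ⟨⟨x0, t0⟩, hm, hmin⟩ := hcomp.exists_isMinOn
    (hne.closure.prod ⟨0, le_refl _, hT.le⟩) hzc.continuousOn
  obtain ⟨hx0, ht0⟩ := hm
  simp only at hx0 ht0
  have hmin' : ∀ x ∈ closure Ω, ∀ t, 0 ≤ t → t ≤ T → z x0 t0 ≤ z x t := fun x hx t h1 h2 =>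
    isMinOn_iff.1 hmin (x, t) ⟨hx, h1, h2⟩
  suffices h : 0 ≤ z x0 t0 from fun x hx t h1 h2 => h.trans (hmin' x hx t h1 h2)
  by_contra hneg
  push Not at hneg
  have ht0p : 0 < t0 := by
    rcases ht0.1.lt_or_eq with h | h
    · exact h
    · rw [← h] at hneg
      exact absurd (hic x0 hx0) (not_le.2 hneg)
  by_cases hxin : x0 ∈ Ω
  · have h1 : deriv (z x0) t0 ≤ 0 := left_deriv_sign ht0p (hzt x0 t0)
      fun s hs1 hs2 => hmin' x0 hx0 s hs1 (hs2.trans ht0.2)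
    have h2 : ellOp k (fun y => z y t0) x0 ≤ 0 := by
      refine ellOp_nonpos_of_min k _ x0 (hkd x0 hxin) (hk x0 hx0).le (hz2 t0) ?_
      filter_upwards [hΩo.mem_nhds hxin] with y hy
      exact hmin' y (subset_closure hy) t0 ht0.1 ht0.2
    have h3 := mul_nonpos_of_nonneg_of_nonpos (hc x0 hxin) hneg.le
    have := hpde x0 hxin t0 ht0p ht0.2
    linarith
  · have hfr : x0 ∈ frontier Ω := by
      rw [hΩo.frontier_eq]
      exact ⟨hx0, hxin⟩
    set ℓ := fderiv ℝ (fun y => z y t0) x0 with hℓ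
    have hder : HasFDerivAt (fun y => z y t0) ℓ x0 :=
      ((hz2 t0).differentiable (by norm_num) x0).hasFDerivAt
    have hdir : ∀ y ∈ closure Ω, 0 ≤ ℓ (y - x0) := by
      intro y hy
      have hl : HasDerivAt (fun s : ℝ => x0 - s • (y - x0)) (-(y - x0)) 0 := by
        simpa using ((hasDerivAt_id (0:ℝ)).smul_const (y - x0)).const_sub x0
      have hder' : HasFDerivAt (fun y => z y t0) ℓ (x0 - (0:ℝ) • (y - x0)) := by simpa using hder
      have hd := hder'.comp_hasDerivAt (0:ℝ) hl
      have := left_deriv_sign (g := fun s : ℝ => z (x0 - s • (y - x0)) t0) (a := -1) (t := 0)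
        (by norm_num) hd.differentiableAt (fun s hs1 hs2 => by
          have : x0 - s • (y - x0) ∈ closure Ω := by
            have := hΩconv.closure hx0 hy (a := 1 + s) (b := -s) (by linarith) (by linarith)
              (by ring)
            convert this using 1
            module
          simpa using hmin' _ this t0 ht0.1 ht0.2)
      have hdd : deriv (fun s : ℝ => z (x0 - s • (y - x0)) t0) 0 = ℓ (-(y - x0)) := hd.deriv
      rw [hdd, map_neg] at this
      linarith
    have hpos : ∀ ν : E2, ‖ν‖ = 1 → (∀ y ∈ closure Ω, (inner ℝ ν (y - x0) : ℝ) ≤ 0) → 0 < ℓ ν := by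
      intro ν hν hν2
      have h1 := hrob x0 hfr ν hν hν2 t0 ht0p ht0.2
      have h2 := mul_nonpos_of_nonneg_of_nonpos (hμ x0 hfr) hneg.le
      have h3 : 0 < k x0 * ℓ ν := by linarith
      exact (mul_pos_iff_of_pos_left (hk x0 hx0)).1 h3
    set w := (InnerProductSpace.toDual ℝ E2).symm ℓ with hw
    have hwi : ∀ y, inner ℝ w y = ℓ y := fun y => InnerProductSpace.toDual_symm_apply
    by_cases hw0 : w = 0
    · obtain ⟨ν, h1, h2⟩ := exists_normal Ω hΩo hΩconv x0 hne hxin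
      have := hpos ν h1 h2
      rw [← hwi, hw0] at this
      simp at this
    · have hn : ‖-(‖w‖⁻¹ • w)‖ = 1 := by
        rw [norm_neg]
        exact norm_smul_inv_norm hw0
      have h1 := hpos (-(‖w‖⁻¹ • w)) hn (fun y hy => by
        rw [inner_neg_left, inner_smul_left, hwi]
        have := mul_nonneg (inv_nonneg.2 (norm_nonneg w)) (hdir y hy)
        simpa using this)
      rw [map_neg, map_smul, ← hwi, real_inner_self_eq_norm_sq, smul_eq_mul] at h1
      have : 0 ≤ ‖w‖⁻¹ * ‖w‖ ^ 2 := by positivity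
      linarith

theorem weak_max (Ω : Set E2) (hΩo : IsOpen Ω) (hΩb : Bornology.IsBounded Ω)
    (hΩconv : Convex ℝ Ω) (T : ℝ) (hT : 0 < T)
    (k μ c : E2 → ℝ) (hk : ∀ x ∈ closure Ω, 0 < k x) (hkC1 : ContDiffOn ℝ 1 k (closure Ω))
    (hμ : ∀ x ∈ frontier Ω, 0 ≤ μ x) (hc : ∀ x ∈ Ω, 0 ≤ c x)
    (f z : E2 → ℝ → ℝ) (hz : ContDiff ℝ 2 (Function.uncurry z))
    (hf : ∀ x ∈ Ω, ∀ t, 0 < t → t ≤ T → 0 ≤ f x t)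
    (hpde : ∀ x ∈ Ω, ∀ t : ℝ, 0 < t → t ≤ T →
      deriv (z x) t + ellOp k (fun y => z y t) x + c x * z x t = f x t)
    (hic : ∀ x ∈ Ω, 0 ≤ z x 0)
    (hrob : ∀ x ∈ frontier Ω, ∀ ν : E2, ‖ν‖ = 1 →
      (∀ y ∈ closure Ω, (inner ℝ ν (y - x) : ℝ) ≤ 0) → ∀ t : ℝ, 0 < t → t ≤ T →
      k x * fderiv ℝ (fun y => z y t) x ν + μ x * z x t = 0) :
    ∀ x ∈ Ω, ∀ t, 0 ≤ t → t ≤ T → 0 ≤ z x t := by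
  intro x hx t ht1 ht2
  have hne : Ω.Nonempty := ⟨x, hx⟩
  have hkd : ∀ x ∈ Ω, DifferentiableAt ℝ k x := fun x hx =>
    (hkC1.differentiableOn (by norm_num)).differentiableAt
      (Filter.mem_of_superset (hΩo.mem_nhds hx) subset_closure)
  have hz2 : ∀ t, ContDiff ℝ 2 (fun y => z y t) := fun t =>
    hz.comp (contDiff_id.prodMk contDiff_const)
  have hzt : ∀ x t, DifferentiableAt ℝ (z x) t := fun x t =>
    ((hz.comp (contDiff_const.prodMk contDiff_id)).differentiable (by norm_num) :
      Differentiable ℝ (fun t => z x t)) t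
  have hic' : ∀ y ∈ closure Ω, 0 ≤ z y 0 := fun y hy =>
    (closure_minimal (t := {y | 0 ≤ z y 0}) (fun y hy => hic y hy)
      (isClosed_le continuous_const (hz2 0).continuous)) hy
  obtain ⟨r, hr, hball⟩ := Metric.isOpen_iff.1 hΩo x hx
  have hh : ∀ b : ℝ, ContDiff ℝ 2 (fun y : E2 => ‖y - x‖ ^ 2 + b) := fun b =>
    ((contDiff_id.sub contDiff_const).norm_sq ℝ).add contDiff_const
  obtain ⟨C, hC⟩ := ellOp_bdd Ω hΩo hΩb hΩconv hne k hkC1 _ (hh 0)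
  have hC0 : 0 ≤ C := (abs_nonneg _).trans (hC x hx)
  have hCb : ∀ b, ∀ y ∈ Ω, -C ≤ ellOp k (fun y : E2 => ‖y - x‖ ^ 2 + b) y := by
    intro b y hy
    have : ellOp k (fun y : E2 => ‖y - x‖ ^ 2 + b) y = ellOp k (fun y : E2 => ‖y - x‖ ^ 2 + 0) y := by
      have e : ∀ b, fderiv ℝ (fun y : E2 => ‖y - x‖ ^ 2 + b) = fderiv ℝ (fun y : E2 => ‖y - x‖ ^ 2) := by
        intro b
        funext y
        exact fderiv_add_const b
      rw [ellOp_eq k _ y (hkd y hy) (hh b), ellOp_eq k _ y (hkd y hy) (hh 0), e b, e 0]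
    rw [this]
    exact (abs_le.1 (hC y hy)).1
  have hhd : ∀ b (y ν : E2), fderiv ℝ (fun y : E2 => ‖y - x‖ ^ 2 + b) y ν = 2 * inner ℝ ν (y - x) := by
    intro b y ν
    have h1 : HasFDerivAt (fun y : E2 => ‖y - x‖ ^ 2 + b) _ y :=
      (((hasFDerivAt_id y).sub_const x).norm_sq).add_const b
    rw [h1.fderiv]
    rw [real_inner_comm]
    simp [inner_sub_left]
  have main : ∀ ε > 0, 0 ≤ z x t + ε * ((C + 1) * t) := by
    intro ε hε
    have := strict_max Ω hΩo hΩb hΩconv hne T hT k μ c hk hkd hμ hc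
      (fun y s => z y s + ε * (‖y - x‖ ^ 2 + (C + 1) * s)) ?_ ?_ ?_ ?_ ?_ ?_ x
      (subset_closure hx) t ht1 ht2
    · simpa using this
    · have := hz.continuous
      have h2 : Continuous fun p : E2 × ℝ => ε * (‖p.1 - x‖ ^ 2 + (C + 1) * p.2) := by fun_prop
      exact this.add h2
    · exact fun s => (hz2 s).add (contDiff_const.mul (hh _))
    · intro y s
      exact (hzt y s).add (by fun_prop)
    · intro y hy s hs1 hs2
      have e1 : deriv (fun s => z y s + ε * (‖y - x‖ ^ 2 + (C + 1) * s)) s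
          = deriv (z y) s + ε * (C + 1) := by
        have a := (((hasDerivAt_id s).const_mul (C+1)).const_add (‖y - x‖ ^ 2)).const_mul ε
        have b := ((hzt y s).hasDerivAt.add a).deriv
        simp only [mul_one] at b
        exact b
      have e2 := ellOp_lin k (fun y => z y s) (fun y => ‖y - x‖ ^ 2 + (C + 1) * s) ε y (hkd y hy)
        (hz2 s) (hh _)
      beta_reduce
      rw [e1, e2]
      have h1 := hpde y hy s hs1 hs2
      have h2 := hf y hy s hs1 hs2
      have h3 := mul_le_mul_of_nonneg_left (hCb ((C + 1) * s) y hy) hε.le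
      have h4 : 0 ≤ c y * (ε * (‖y - x‖ ^ 2 + (C + 1) * s)) := by
        have := hc y hy
        positivity
      nlinarith
    · intro y hy
      have := hic' y hy
      have h2 : 0 ≤ ε * ‖y - x‖ ^ 2 := by positivity
      simp only [mul_zero, add_zero]
      linarith
    · intro y hy ν hν hν2 s hs1 hs2
      have e1 : fderiv ℝ (fun y => z y s + ε * (‖y - x‖ ^ 2 + (C + 1) * s)) y ν
          = fderiv ℝ (fun y => z y s) y ν + ε * (2 * inner ℝ ν (y - x)) := by
        have a1 := ((hz2 s).differentiable (by norm_num)) y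
        have a2 := ((hh ((C + 1) * s)).differentiable (by norm_num)) y
        have := (a1.hasFDerivAt.add (a2.hasFDerivAt.const_mul ε)).fderiv
        have h3 : fderiv ℝ (fun y => z y s + ε * (‖y - x‖ ^ 2 + (C + 1) * s)) y = _ := this
        rw [h3]
        simp only [add_apply, smul_apply, hhd, smul_eq_mul]
      have h1 := hrob y hy ν hν hν2 s hs1 hs2
      have hin : 0 < inner ℝ ν (y - x) := by
        have hmem : x + (r/2) • ν ∈ closure Ω := by
          refine subset_closure (hball ?_)
          rw [Metric.mem_ball, dist_eq_norm, add_sub_cancel_left, norm_smul, hν, Real.norm_eq_abs,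
            abs_of_pos (by linarith)]
          linarith
        have := hν2 _ hmem
        have e : x + (r/2) • ν - y = (r/2) • ν - (y - x) := by abel
        rw [e, inner_sub_right, inner_smul_right, real_inner_self_eq_norm_sq, hν] at this
        linarith
      have hky := hk y (frontier_subset_closure hy)
      have hmy := hμ y hy
      beta_reduce
      rw [e1]
      have h2 : 0 < k y * (ε * (2 * inner ℝ ν (y - x))) := by positivity
      have h3 : 0 ≤ μ y * (ε * (‖y - x‖ ^ 2 + (C + 1) * s)) := by positivity
      linarith
  by_contra hneg
  push Not at hneg
  have hp : 0 < (C + 1) * t + 1 := by positivity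
  have := main (-(z x t) / 2 / ((C + 1) * t + 1)) (by apply div_pos <;> linarith)
  have h2 : -(z x t) / 2 / ((C + 1) * t + 1) * ((C + 1) * t) ≤ -(z x t) / 2 := by
    rw [div_mul_eq_mul_div, div_le_iff₀ hp]
    nlinarith
  linarith

theorem deriv_nonneg_of_sol (Ω : Set E2) (hΩo : IsOpen Ω) (hΩb : Bornology.IsBounded Ω)
    (hΩconv : Convex ℝ Ω) (T : ℝ) (hT : 0 < T)
    (k μ c : E2 → ℝ) (hk : ∀ x ∈ closure Ω, 0 < k x) (hkC1 : ContDiffOn ℝ 1 k (closure Ω))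
    (hμ : ∀ x ∈ frontier Ω, 0 ≤ μ x) (hc : ∀ x ∈ Ω, 0 ≤ c x)
    (f u : E2 → ℝ → ℝ) (hu : ContDiff ℝ (⊤ : ℕ∞) (Function.uncurry u))
    (hf0 : ∀ x ∈ Ω, f x 0 = 0)
    (hft : ∀ x ∈ Ω, ∀ t : ℝ, 0 ≤ t → t ≤ T → 0 < deriv (f x) t)
    (hs : IsDirectSolution Ω T k μ c f u) : ∀ x ∈ Ω, 0 ≤ deriv (u x) T := by
  have hu2 : ContDiff ℝ 2 (Function.uncurry u) := contDiff_infty.1 hu 2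
  have hmono : ∀ x ∈ Ω, MonotoneOn (f x) (Set.Icc 0 T) := by
    intro x hx
    have hd : ∀ t ∈ Set.Icc 0 T, DifferentiableAt ℝ (f x) t := fun t ht =>
      differentiableAt_of_deriv_ne_zero (hft x hx t ht.1 ht.2).ne'
    refine monotoneOn_of_deriv_nonneg (convex_Icc 0 T)
      (fun t ht => (hd t ht).continuousAt.continuousWithinAt)
      (fun t ht => (hd t (interior_subset ht)).differentiableWithinAt) (fun t ht => ?_)
    have := interior_subset ht
    exact (hft x hx t this.1 this.2).le
  have hut : ∀ x t, DifferentiableAt ℝ (u x) t := fun x t =>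
    ((hu2.comp (contDiff_const.prodMk contDiff_id)).differentiable (by norm_num) :
      Differentiable ℝ (fun t => u x t)) t
  have hux : ∀ t, ContDiff ℝ 2 (fun y => u y t) := fun t =>
    hu2.comp (contDiff_id.prodMk contDiff_const)
  have hkd : ∀ x ∈ Ω, DifferentiableAt ℝ k x := fun x hx =>
    (hkC1.differentiableOn (by norm_num)).differentiableAt
      (Filter.mem_of_superset (hΩo.mem_nhds hx) subset_closure)
  have hpos : ∀ x ∈ Ω, ∀ t, 0 ≤ t → t ≤ T → 0 ≤ u x t :=
    weak_max Ω hΩo hΩb hΩconv T hT k μ c hk hkC1 hμ hc f u hu2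
      (fun x hx t h1 h2 => by
        rw [← hf0 x hx]
        exact hmono x hx ⟨le_refl _, hT.le⟩ ⟨h1.le, h2⟩ h1.le)
      hs.pde (fun x hx => (hs.ic x hx).ge) hs.robin
  have hinc : ∀ δ, 0 < δ → δ < T → ∀ x ∈ Ω, u x (T - δ) ≤ u x T := by
    intro δ hδ hδT x hx
    have := weak_max Ω hΩo hΩb hΩconv (T - δ) (by linarith) k μ c hk hkC1 hμ hc
      (fun x t => f x (t + δ) + (-1) * f x t) (fun x t => u x (t + δ) + (-1) * u x t) ?_ ?_ ?_ ?_ ?_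
      x hx (T - δ) (by linarith) le_rfl
    · simp only [sub_add_cancel] at this
      linarith
    · have a : ContDiff ℝ 2 (fun p : E2 × ℝ => Function.uncurry u (p.1, p.2 + δ)) :=
        hu2.comp (contDiff_fst.prodMk (contDiff_snd.add contDiff_const))
      exact a.add (contDiff_const.mul hu2)
    · intro y hy t h1 h2
      have := hmono y hy ⟨h1.le, by linarith⟩ ⟨by linarith, by linarith⟩
        (show t ≤ t + δ by linarith)
      linarith
    · intro y hy t h1 h2
      have e1 : deriv (fun t => u y (t + δ) + (-1) * u y t) t
          = deriv (u y) (t + δ) + (-1) * deriv (u y) t := by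
        have a := (hut y (t + δ)).hasDerivAt.comp_add_const t δ
        exact (a.add ((hut y t).hasDerivAt.const_mul (-1))).deriv
      have e2 := ellOp_lin k (fun y => u y (t + δ)) (fun y => u y t) (-1) y (hkd y hy)
        (hux _) (hux _)
      have p1 := hs.pde y hy (t + δ) (by linarith) (by linarith)
      have p2 := hs.pde y hy t (by linarith) (by linarith)
      beta_reduce
      rw [e1, e2]
      linarith
    · intro y hy
      have h1 := hpos y hy δ hδ.le hδT.le
      have h2 := hs.ic y hy
      simp only [zero_add, h2]
      linarith
    · intro y hy ν hν hν2 t h1 h2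
      have p1 := hs.robin y hy ν hν hν2 (t + δ) (by linarith) (by linarith)
      have p2 := hs.robin y hy ν hν hν2 t (by linarith) (by linarith)
      have a1 := ((hux (t + δ)).differentiable (by norm_num)) y
      have a2 := ((hux t).differentiable (by norm_num)) y
      have h3 : fderiv ℝ (fun y => u y (t + δ) + (-1) * u y t) y = _ :=
        (a1.hasFDerivAt.add (a2.hasFDerivAt.const_mul (-1))).fderiv
      beta_reduce
      rw [h3]
      simp only [add_apply, smul_apply, smul_eq_mul]
      linarith
  intro x hx
  have := left_deriv_sign (g := fun t => - u x t) (a := T/2) (t := T) (by linarith)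
    (hut x T).neg (fun s h1 h2 => by
      rcases h2.lt_or_eq with h | h
      · have := hinc (T - s) (by linarith) (by linarith) x hx
        rw [sub_sub_cancel] at this
        linarith
      · rw [h])
  have e : deriv (fun t => - u x t) T = - deriv (u x) T := (hut x T).hasDerivAt.neg.deriv
  rw [e] at this
  linarith

/-- for the iterative process started from the initial approximation (16),
the first iterate satisfies `c¹(x) ≤ c⁰(x)` on `Ω`. -/
theorem first_iterate_le_initial
    (Ω : Set E2) (hΩo : IsOpen Ω) (hΩb : Bornology.IsBounded Ω) (hΩconv : Convex ℝ Ω)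
    (T : ℝ) (hT : 0 < T)
    (k μ : E2 → ℝ) (k₁ k₂ : ℝ) (hk₁ : 0 < k₁)
    (hkbd : ∀ x ∈ closure Ω, k₁ ≤ k x ∧ k x ≤ k₂)
    (hkC1 : ContDiffOn ℝ 1 k (closure Ω))
    (hμ : ∀ x ∈ frontier Ω, 0 ≤ μ x)
    (f : E2 → ℝ → ℝ) (hf : ContDiff ℝ (⊤ : ℕ∞) (Function.uncurry f))
    (c : E2 → ℝ) (hc : ∀ x ∈ Ω, 0 ≤ c x)
    (u : E2 → ℝ → ℝ) (hureg : ContDiff ℝ (⊤ : ℕ∞) (Function.uncurry u))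
    (hu : IsDirectSolution Ω T k μ c f u)
    (hf0 : ∀ x ∈ Ω, f x 0 = 0)
    (hft : ∀ x ∈ Ω, ∀ t : ℝ, 0 ≤ t → t ≤ T → 0 < deriv (f x) t)
    (ψ : E2 → ℝ) (hψdef : ∀ x, ψ x = u x T) (hψpos : ∀ x ∈ Ω, 0 < ψ x)
    (c0 : E2 → ℝ) (hc0 : ∀ x ∈ Ω, c0 x * ψ x = - ellOp k ψ x + f x T)
    (u0 : E2 → ℝ → ℝ) (hu0reg : ContDiff ℝ (⊤ : ℕ∞) (Function.uncurry u0))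
    (hu0 : IsDirectSolution Ω T k μ c0 f u0)
    (c1 : E2 → ℝ)
    (hc1 : ∀ x ∈ Ω, c1 x * ψ x = - deriv (u0 x) T - ellOp k ψ x + f x T) :
    ∀ x ∈ Ω, c1 x ≤ c0 x := by
  have hk : ∀ x ∈ closure Ω, 0 < k x := fun x hx => hk₁.trans_le (hkbd x hx).1
  have hψ : ψ = fun y => u y T := funext hψdef
  have h1 := deriv_nonneg_of_sol Ω hΩo hΩb hΩconv T hT k μ c hk hkC1 hμ hc f u hureg hf0 hft hu
  have hc0' : ∀ x ∈ Ω, 0 ≤ c0 x := by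
    intro x hx
    have a := hu.pde x hx T hT le_rfl
    have b := hc0 x hx
    have p := hψpos x hx
    rw [← hψ, ← hψdef] at a
    have d := mul_nonneg (hc x hx) p.le
    have e := h1 x hx
    exact nonneg_of_mul_nonneg_left (show 0 ≤ c0 x * ψ x by linarith) p
  have h2 := deriv_nonneg_of_sol Ω hΩo hΩb hΩconv T hT k μ c0 hk hkC1 hμ hc0' f u0 hu0reg hf0 hft hu0
  intro x hx
  have a := hc1 x hx
  have b := hc0 x hx
  have d := h2 x hx
  exact le_of_mul_le_mul_right (show c1 x * ψ x ≤ c0 x * ψ x by linarith) (hψpos x hx)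

end
end

section
/- Consider the inverse-problem setting with exact coefficient c satisfying c(x) ≥ 0 on Ω and f satisfying condition (7), and the iterative process started from the initial approximation (16), with sufficiently smooth iterates u⁰, u¹ and coefficients c⁰, c¹. Then w¹ = u¹ − u⁰ satisfies w¹(x,t) ≥ 0 for all x ∈ Ω, 0 < t ≤ T, and ξ¹ = c¹ − c⁰ satisfies ξ¹(x) ≤ 0 for all x ∈ Ω. -/
noncomputable section

lemma aux_deriv_nonneg {g : ℝ → ℝ} {a t : ℝ} (hg : DifferentiableAt ℝ g t) (hat : a < t)
    (h : ∀ s, a ≤ s → s < t → g s ≤ g t) : 0 ≤ deriv g t := by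
  have h1 := hg.hasDerivAt.hasDerivWithinAt (s := Set.Iio t)
  rw [hasDerivWithinAt_iff_tendsto_slope' (by simp)] at h1
  refine ge_of_tendsto h1 ?_
  filter_upwards [Ioo_mem_nhdsLT hat] with s hs
  rw [slope_def_field]
  exact div_nonneg_of_nonpos (by linarith [h s hs.1.le hs.2]) (by linarith [hs.2])

lemma aux_second {g : ℝ → ℝ} (h : IsLocalMin g 0) (hc : ContinuousAt g 0) :
    0 ≤ deriv (deriv g) 0 := by
  by_contra hn
  push Not at hn
  have h0 := h.deriv_eq_zero
  have h2 := isLocalMax_of_deriv_deriv_neg hn h0 hc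
  have h3 : g =ᶠ[nhds 0] fun _ => g 0 := by
    filter_upwards [h, h2] with s h4 h5 using le_antisymm h5 h4
  have h6 := h3.deriv.deriv_eq
  simp at h6
  linarith

lemma aux_grad {v : E2 → ℝ} (hv : ContDiff ℝ (⊤ : ℕ∞) v) : ContDiff ℝ 1 (gradient v) := by
  have h1 : ContDiff ℝ 1 (fderiv ℝ v) := hv.fderiv_right (by norm_cast)
  exact (InnerProductSpace.toDual ℝ E2).symm.toContinuousLinearEquiv.contDiff.comp h1

lemma aux_ell {k v : E2 → ℝ} {x : E2} (hk : DifferentiableAt ℝ k x)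
    (hv : ContDiff ℝ (⊤ : ℕ∞) v) :
    ellOp k v x = - ∑ i : Fin 2, (k x * fderiv ℝ (gradient v) x (EuclideanSpace.single i 1) i
      + fderiv ℝ k x (EuclideanSpace.single i 1) * gradient v x i) := by
  have h1 : DifferentiableAt ℝ (gradient v) x :=
    (aux_grad hv).differentiable (by norm_num) x
  unfold ellOp
  rw [fderiv_fun_smul hk h1]
  simp

lemma aux_grad_add {v w : E2 → ℝ} (hv : ContDiff ℝ (⊤ : ℕ∞) v)
    (hw : ContDiff ℝ (⊤ : ℕ∞) w) (a : ℝ) :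
    gradient (fun y => v y + a * w y) = fun y => gradient v y + a • gradient w y := by
  ext1 y
  have h1 := hv.differentiable (by simp) y
  have h2 := hw.differentiable (by simp) y
  unfold gradient
  rw [fderiv_fun_add h1 (h2.const_mul a), fderiv_const_mul h2]
  simp

lemma aux_ell_add {k v w : E2 → ℝ} {x : E2} (hk : DifferentiableAt ℝ k x)
    (hv : ContDiff ℝ (⊤ : ℕ∞) v) (hw : ContDiff ℝ (⊤ : ℕ∞) w) (a : ℝ) :
    ellOp k (fun y => v y + a * w y) x = ellOp k v x + a * ellOp k w x := by
  rw [aux_ell hk (by fun_prop), aux_ell hk hv, aux_ell hk hw, aux_grad_add hv hw]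
  have h1 : DifferentiableAt ℝ (gradient v) x :=
    (aux_grad hv).differentiable (by norm_num) x
  have h2 : DifferentiableAt ℝ (gradient w) x :=
    (aux_grad hw).differentiable (by norm_num) x
  have h3 : fderiv ℝ (fun y => gradient v y + a • gradient w y) x
      = fderiv ℝ (gradient v) x + a • fderiv ℝ (gradient w) x :=
    (h1.hasFDerivAt.add (h2.hasFDerivAt.const_smul a)).fderiv
  rw [h3]
  simp
  ring

lemma aux_ell_sub {k v w : E2 → ℝ} {x : E2} (hk : DifferentiableAt ℝ k x)
    (hv : ContDiff ℝ (⊤ : ℕ∞) v) (hw : ContDiff ℝ (⊤ : ℕ∞) w) :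
    ellOp k (fun y => v y - w y) x = ellOp k v x - ellOp k w x := by
  have := aux_ell_add hk hv hw (-1)
  simp only [neg_mul, one_mul, ← sub_eq_add_neg] at this
  exact this

lemma aux_fderiv_sub {v w : E2 → ℝ} {x : E2}
    (hv : ContDiff ℝ (⊤ : ℕ∞) v) (hw : ContDiff ℝ (⊤ : ℕ∞) w) (ν : E2) :
    fderiv ℝ (fun y => v y - w y) x ν = fderiv ℝ v x ν - fderiv ℝ w x ν := by
  rw [fderiv_fun_sub (hv.differentiable (by simp) x) (hw.differentiable (by simp) x)]
  simp

lemma aux_ell_min {k v : E2 → ℝ} {x : E2} (hk : DifferentiableAt ℝ k x) (hk0 : 0 ≤ k x)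
    (hv : ContDiff ℝ (⊤ : ℕ∞) v) (hmin : IsLocalMin v x) : ellOp k v x ≤ 0 := by
  rw [aux_ell hk hv, neg_nonpos]
  have hg0 : gradient v x = 0 := by
    unfold gradient; rw [hmin.fderiv_eq_zero]; simp
  apply Finset.sum_nonneg
  intro i _
  rw [hg0]
  simp only [PiLp.zero_apply, mul_zero, add_zero]
  apply mul_nonneg hk0
  set e : E2 := EuclideanSpace.single i 1 with he
  have hline : ∀ s : ℝ, HasDerivAt (fun s : ℝ => x + s • e) e s := by
    intro s
    simpa using ((hasDerivAt_id s).smul_const e).const_add x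
  have hd : deriv (fun s : ℝ => v (x + s • e)) = fun s => gradient v (x + s • e) i := by
    ext s
    have h1 := ((hv.differentiable (by simp) (x + s • e)).hasFDerivAt.comp_hasDerivAt s (hline s))
    rw [show deriv (fun s : ℝ => v (x + s • e)) s = _ from h1.deriv]
    have h2 : inner ℝ (gradient v (x + s • e)) e = fderiv ℝ v (x + s • e) e := by
      unfold gradient; simp
    rw [← h2, he, EuclideanSpace.inner_single_right]
    simp
  have hdd : deriv (deriv (fun s : ℝ => v (x + s • e))) 0 = fderiv ℝ (gradient v) x e i := by
    rw [hd]
    have h1 : HasFDerivAt (gradient v) (fderiv ℝ (gradient v) (x + (0:ℝ) • e)) (x + (0:ℝ) • e) :=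
      ((aux_grad hv).differentiable (by norm_num) _).hasFDerivAt
    have h2 := h1.comp_hasDerivAt (0:ℝ) (hline 0)
    have h3 := ((EuclideanSpace.proj i : E2 →L[ℝ] ℝ).hasFDerivAt).comp_hasDerivAt (0:ℝ) h2
    have h4 := h3.deriv
    simp only [zero_smul, add_zero] at h4
    exact h4
  rw [← hdd]
  have hcl : Continuous (fun s : ℝ => x + s • e) := by fun_prop
  apply aux_second
  · have : Filter.Tendsto (fun s : ℝ => x + s • e) (nhds 0) (nhds x) := by
      have := hcl.tendsto 0
      simpa using this
    have h5 := this.eventually hmin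
    simpa [IsLocalMin, IsMinFilter] using h5
  · exact (hv.continuous.comp hcl).continuousAt

lemma aux_phi_smooth (p : E2) : ContDiff ℝ (⊤ : ℕ∞) (fun y : E2 => ‖y - p‖ ^ 2) :=
  (contDiff_id.sub contDiff_const).norm_sq ℝ

lemma aux_phi_fderiv (p x ν : E2) :
    fderiv ℝ (fun y : E2 => ‖y - p‖ ^ 2) x ν = 2 * inner ℝ (x - p) ν := by
  have h := ((hasFDerivAt_id x).sub_const p).norm_sq
  rw [show fderiv ℝ (fun y : E2 => ‖y - p‖ ^ 2) x = _ from h.fderiv]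
  simp [inner_sub_left]

lemma aux_phi_grad (p : E2) :
    gradient (fun y : E2 => ‖y - p‖ ^ 2) = fun y => (2:ℝ) • (y - p) := by
  ext1 x
  apply (InnerProductSpace.toDual ℝ E2).injective
  ext ν
  unfold gradient
  simp only [LinearIsometryEquiv.apply_symm_apply]
  rw [aux_phi_fderiv]
  simp [inner_sub_left]

lemma aux_phi_ell {k : E2 → ℝ} {x : E2} (p : E2) (hk : DifferentiableAt ℝ k x) :
    ellOp k (fun y : E2 => ‖y - p‖ ^ 2) x = - (4 * k x + 2 * fderiv ℝ k x (x - p)) := by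
  rw [aux_ell hk (aux_phi_smooth p), aux_phi_grad]
  have h : fderiv ℝ (fun y : E2 => (2:ℝ) • (y - p)) x = (2:ℝ) • ContinuousLinearMap.id ℝ E2 :=
    (((hasFDerivAt_id x).sub_const p).const_smul (2:ℝ)).fderiv
  rw [h]
  have h2 : x - p = (x - p) 0 • EuclideanSpace.single (0 : Fin 2) (1:ℝ)
      + (x - p) 1 • EuclideanSpace.single (1 : Fin 2) (1:ℝ) := by
    ext i; fin_cases i <;> simp
  have h3 : fderiv ℝ k x (x - p) = (x - p) 0 * fderiv ℝ k x (EuclideanSpace.single (0 : Fin 2) (1:ℝ))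
      + (x - p) 1 * fderiv ℝ k x (EuclideanSpace.single (1 : Fin 2) (1:ℝ)) := by
    conv_lhs => rw [h2]
    simp
  rw [h3]
  simp
  ring

lemma aux_normal {Ω : Set E2} (hΩo : IsOpen Ω) (hΩconv : Convex ℝ Ω) {x p : E2} (hp : p ∈ Ω)
    (hx : x ∉ Ω) : ∃ ν : E2, ‖ν‖ = 1 ∧ ∀ y ∈ closure Ω, (inner ℝ ν (y - x) : ℝ) ≤ 0 := by
  obtain ⟨g, hg⟩ := geometric_hahn_banach_open_point hΩconv hΩo hx
  set n := (InnerProductSpace.toDual ℝ E2).symm g with hn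
  have hin : ∀ y, inner ℝ n y = g y := by intro y; simp [hn]
  have hn0 : n ≠ 0 := by
    intro h
    have := hg p hp
    rw [← hin, ← hin, h] at this
    simp at this
  refine ⟨‖n‖⁻¹ • n, ?_, ?_⟩
  · rw [norm_smul, norm_inv, norm_norm, inv_mul_cancel₀ (norm_ne_zero_iff.mpr hn0)]
  · have hcl : closure Ω ⊆ {y | g y ≤ g x} :=
      closure_minimal (fun y hy => (hg y hy).le) (isClosed_le g.continuous continuous_const)
    intro y hy
    rw [real_inner_smul_left, inner_sub_right, hin, hin]
    have := hcl hy
    exact mul_nonpos_of_nonneg_of_nonpos (by positivity) (by simpa using this)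

lemma aux_normal_strict {Ω : Set E2} (hΩo : IsOpen Ω) {x p ν : E2} (hp : p ∈ Ω) (hν : ‖ν‖ = 1)
    (h : ∀ y ∈ closure Ω, (inner ℝ ν (y - x) : ℝ) ≤ 0) : 0 < (inner ℝ (x - p) ν : ℝ) := by
  obtain ⟨r, hr, hball⟩ := Metric.isOpen_iff.mp hΩo p hp
  have h1 : p + (r/2) • ν ∈ Ω := by
    apply hball
    simp [norm_smul, hν, abs_of_pos hr]
    linarith
  have h2 := h _ (subset_closure h1)
  rw [show p + (r/2) • ν - x = (r/2) • ν - (x - p) by abel, inner_sub_right,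
    real_inner_smul_right, real_inner_self_eq_norm_sq, hν, real_inner_comm] at h2
  linarith

lemma aux_kbound {Ω : Set E2} (hΩo : IsOpen Ω) (hΩb : Bornology.IsBounded Ω)
    (hΩconv : Convex ℝ Ω) (hne : Ω.Nonempty) {k : E2 → ℝ} (hkC1 : ContDiffOn ℝ 1 k (closure Ω)) :
    ∃ K, 0 ≤ K ∧ ∀ x ∈ Ω, ‖fderiv ℝ k x‖ ≤ K := by
  have hu : UniqueDiffOn ℝ (closure Ω) := by
    apply uniqueDiffOn_convex hΩconv.closure
    exact hne.mono (interior_maximal subset_closure hΩo)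
  have hcont := hkC1.continuousOn_fderivWithin hu (le_refl _)
  obtain ⟨K, hK⟩ := hΩb.isCompact_closure.exists_bound_of_continuousOn hcont
  refine ⟨max K 0, le_max_right _ _, fun x hx => ?_⟩
  have h1 := hK x (subset_closure hx)
  rw [fderivWithin_of_mem_nhds (Filter.mem_of_superset (hΩo.mem_nhds hx) subset_closure)] at h1
  exact h1.trans (le_max_left _ _)

lemma aux_slice {v : E2 → ℝ → ℝ} (hv : ContDiff ℝ (⊤ : ℕ∞) (Function.uncurry v)) (t : ℝ) :
    ContDiff ℝ (⊤ : ℕ∞) (fun y => v y t) :=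
  hv.comp (contDiff_id.prodMk contDiff_const)

lemma aux_slice' {v : E2 → ℝ → ℝ} (hv : ContDiff ℝ (⊤ : ℕ∞) (Function.uncurry v)) (x : E2) :
    Differentiable ℝ (v x) :=
  (hv.comp (contDiff_const.prodMk contDiff_id : ContDiff ℝ (⊤ : ℕ∞) (fun t : ℝ => (x, t)))).differentiable
    (by simp)

lemma aux_max (Ω : Set E2) (hΩo : IsOpen Ω) (hΩb : Bornology.IsBounded Ω) (hΩconv : Convex ℝ Ω)
    (T : ℝ)
    (k μ : E2 → ℝ) (k₁ k₂ : ℝ) (hk₁ : 0 < k₁)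
    (hkbd : ∀ x ∈ closure Ω, k₁ ≤ k x ∧ k x ≤ k₂)
    (hkC1 : ContDiffOn ℝ 1 k (closure Ω))
    (hμ : ∀ x ∈ frontier Ω, 0 ≤ μ x)
    (c : E2 → ℝ) (hc : ∀ x ∈ Ω, 0 ≤ c x)
    (v : E2 → ℝ → ℝ) (hv : ContDiff ℝ (⊤ : ℕ∞) (Function.uncurry v))
    (hpde : ∀ x ∈ Ω, ∀ t : ℝ, 0 < t → t ≤ T →
      0 ≤ deriv (v x) t + ellOp k (fun y => v y t) x + c x * v x t)
    (hic : ∀ x ∈ Ω, 0 ≤ v x 0)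
    (hrob : ∀ x ∈ frontier Ω, ∀ ν : E2, ‖ν‖ = 1 →
      (∀ y ∈ closure Ω, (inner ℝ ν (y - x) : ℝ) ≤ 0) →
      ∀ t : ℝ, 0 < t → t ≤ T → 0 ≤ k x * fderiv ℝ (fun y => v y t) x ν + μ x * v x t) :
    ∀ x ∈ Ω, ∀ t : ℝ, 0 ≤ t → t ≤ T → 0 ≤ v x t := by
  intro p hp t1 ht1 ht1T
  by_contra hneg
  push Not at hneg
  obtain ⟨K, hK0, hK⟩ := aux_kbound hΩo hΩb hΩconv ⟨p, hp⟩ hkC1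
  obtain ⟨R, hR⟩ := hΩb.subset_closedBall p
  have hkd : ∀ x ∈ Ω, DifferentiableAt ℝ k x := fun x hx =>
    (hkC1.differentiableOn (by norm_num)).differentiableAt
      (Filter.mem_of_superset (hΩo.mem_nhds hx) subset_closure)
  have hR0 : 0 ≤ R := by simpa using hR hp
  have hk2 : 0 < k₂ := by
    have := hkbd p (subset_closure hp); linarith
  set M := 4 * k₂ + 2 * (K * R) + 1 with hM
  have hM0 : 0 < M := by positivity
  have hphi : ∀ x ∈ Ω, 0 < M + ellOp k (fun y : E2 => ‖y - p‖ ^ 2) x := by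
    intro x hx
    rw [aux_phi_ell p (hkd x hx)]
    have h1 := (hkbd x (subset_closure hx)).2
    have h2 : fderiv ℝ k x (x - p) ≤ K * R := by
      refine (le_abs_self _).trans (((fderiv ℝ k x).le_opNorm _).trans ?_)
      have := hR hx
      rw [mem_closedBall_iff_norm] at this
      exact mul_le_mul (hK x hx) this (norm_nonneg _) hK0
    rw [hM]; linarith
  -- choose the perturbation size
  obtain ⟨ε, hε, hεv⟩ : ∃ ε > 0, v p t1 + ε * (M * t1) < 0 := by
    refine ⟨-v p t1 / (2 * (M * t1 + 1)), by apply div_pos <;> [linarith; positivity], ?_⟩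
    have h0 : 0 ≤ M * t1 := by positivity
    have h1 : -v p t1 / (2 * (M * t1 + 1)) * (M * t1) ≤ -v p t1 / 2 := by
      rw [div_mul_eq_mul_div, div_le_div_iff₀ (by positivity) (by norm_num)]
      nlinarith
    linarith
  set V : E2 × ℝ → ℝ := fun q => v q.1 q.2 + ε * (‖q.1 - p‖ ^ 2 + M * q.2) with hV
  have hvc : Continuous (fun q : E2 × ℝ => v q.1 q.2) := hv.continuous
  have hVc : Continuous V := by fun_prop
  have hcomp : IsCompact (closure Ω ×ˢ Set.Icc (0:ℝ) T) :=
    hΩb.isCompact_closure.prod isCompact_Icc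
  obtain ⟨⟨x0, t0⟩, ⟨hx0, ht0⟩, hmin⟩ := hcomp.exists_isMinOn
    ⟨(p, t1), subset_closure hp, ht1, ht1T⟩ hVc.continuousOn
  simp only at hx0 ht0
  have hmin' : ∀ y ∈ closure Ω, ∀ s, 0 ≤ s → s ≤ T → V (x0, t0) ≤ V (y, s) :=
    fun y hy s h1 h2 => hmin (Set.mk_mem_prod hy ⟨h1, h2⟩)
  have hVneg : V (x0, t0) < 0 := by
    refine (hmin' p (subset_closure hp) t1 ht1 ht1T).trans_lt ?_
    simpa [hV] using hεv
  have hvneg : v x0 t0 < 0 := by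
    have h1 : 0 ≤ ε * (‖x0 - p‖ ^ 2 + M * t0) := by
      have := ht0.1; positivity
    simp only [hV] at hVneg
    linarith
  have hvcl : ∀ y ∈ closure Ω, 0 ≤ v y 0 := by
    have hcl : closure Ω ⊆ {y | 0 ≤ v y 0} :=
      closure_minimal (fun y hy => hic y hy)
        (isClosed_le continuous_const (aux_slice hv 0).continuous)
    exact fun y hy => hcl hy
  have ht0pos : 0 < t0 := by
    rcases ht0.1.eq_or_lt with h | h
    · rw [← h] at hvneg; linarith [hvcl x0 hx0]
    · exact h
  set S : E2 → ℝ := fun y => v y t0 + ε * ‖y - p‖ ^ 2 with hS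
  have hvs := aux_slice hv t0
  have hSs : ContDiff ℝ (⊤ : ℕ∞) S := hvs.add (contDiff_const.mul (aux_phi_smooth p))
  have hSmin : ∀ y ∈ closure Ω, S x0 ≤ S y := by
    intro y hy
    have := hmin' y hy t0 ht0.1 ht0.2
    simp only [hV] at this
    simp only [hS]
    linarith
  by_cases hxΩ : x0 ∈ Ω
  · have hloc : IsLocalMin S x0 := by
      filter_upwards [hΩo.mem_nhds hxΩ] with y hy using hSmin y (subset_closure hy)
    have h1 := aux_ell_min (hkd x0 hxΩ) (hk₁.le.trans (hkbd x0 hx0).1) hSs hloc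
    rw [hS, aux_ell_add (hkd x0 hxΩ) hvs (aux_phi_smooth p)] at h1
    have hvd := aux_slice' hv x0 t0
    have h2 : deriv (v x0) t0 + ε * M ≤ 0 := by
      have h3 : HasDerivAt (fun s => -(v x0 s + ε * (M * s))) (-(deriv (v x0) t0 + ε * (M * 1))) t0 :=
        (hvd.hasDerivAt.add (((hasDerivAt_id t0).const_mul M).const_mul ε)).neg
      have h4 := aux_deriv_nonneg h3.differentiableAt ht0pos (by
        intro s hs0 hst
        have := hmin' x0 hx0 s hs0 (hst.le.trans ht0.2)
        simp only [hV] at this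
        linarith)
      rw [h3.deriv] at h4
      linarith
    have h5 := hpde x0 hxΩ t0 ht0pos ht0.2
    have h6 : c x0 * v x0 t0 ≤ 0 := mul_nonpos_of_nonneg_of_nonpos (hc x0 hxΩ) hvneg.le
    have h7 := mul_pos hε (hphi x0 hxΩ)
    linarith
  · have hfr : x0 ∈ frontier Ω := by
      rw [frontier, hΩo.interior_eq]; exact ⟨hx0, hxΩ⟩
    have key : ∀ ν : E2, ‖ν‖ = 1 → (∀ y ∈ closure Ω, (inner ℝ ν (y - x0) : ℝ) ≤ 0) →
        0 < fderiv ℝ S x0 ν := by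
      intro ν hν hn
      have h1 := hrob x0 hfr ν hν hn t0 ht0pos ht0.2
      have h2 := aux_normal_strict hΩo hp hν hn
      have h3 : μ x0 * v x0 t0 ≤ 0 := mul_nonpos_of_nonneg_of_nonpos (hμ x0 hfr) hvneg.le
      have hk0 : 0 < k x0 := hk₁.trans_le (hkbd x0 hx0).1
      have h4 : 0 ≤ fderiv ℝ (fun y => v y t0) x0 ν :=
        nonneg_of_mul_nonneg_right (by linarith) hk0
      have hd := (aux_phi_smooth p).differentiable (by simp) x0
      rw [hS, fderiv_fun_add (hvs.differentiable (by simp) x0) (hd.const_mul ε),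
        fderiv_const_mul hd]
      simp only [add_apply, smul_apply, smul_eq_mul]
      rw [aux_phi_fderiv]
      positivity
    have hgr : ∀ y ∈ closure Ω, 0 ≤ fderiv ℝ S x0 (y - x0) := by
      intro y hy
      have hlm : IsLocalMinOn S (closure Ω) x0 :=
        IsMinOn.localize (fun y hy => hSmin y hy)
      refine hlm.hasFDerivWithinAt_nonneg
        (hSs.differentiable (by simp) x0).hasFDerivAt.hasFDerivWithinAt ?_
      exact sub_mem_posTangentConeAt_of_segment_subset (hΩconv.closure.segment_subset hx0 hy)
    have hin : ∀ y, inner ℝ (gradient S x0) y = fderiv ℝ S x0 y := by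
      intro y; unfold gradient; simp
    by_cases hg : gradient S x0 = 0
    · obtain ⟨ν, hν, hn⟩ := aux_normal hΩo hΩconv hp hxΩ
      have := key ν hν hn
      rw [← hin, hg] at this
      simp at this
    · set n := gradient S x0 with hndef
      have hnn : 0 < ‖n‖ := norm_pos_iff.mpr hg
      have := key (-(‖n‖⁻¹ • n)) (by
          rw [norm_neg, norm_smul, norm_inv, norm_norm, inv_mul_cancel₀ hnn.ne']) (by
          intro y hy
          rw [inner_neg_left, real_inner_smul_left, hin]
          have := hgr y hy
          have : 0 ≤ ‖n‖⁻¹ * fderiv ℝ S x0 (y - x0) := by positivity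
          linarith)
      rw [← hin, inner_neg_right, real_inner_smul_right, real_inner_self_eq_norm_sq] at this
      have : 0 ≤ ‖n‖⁻¹ * ‖n‖ ^ 2 := by positivity
      linarith


lemma aux_sol (Ω : Set E2) (hΩo : IsOpen Ω) (hΩb : Bornology.IsBounded Ω) (hΩconv : Convex ℝ Ω)
    (T : ℝ)
    (k μ : E2 → ℝ) (k₁ k₂ : ℝ) (hk₁ : 0 < k₁)
    (hkbd : ∀ x ∈ closure Ω, k₁ ≤ k x ∧ k x ≤ k₂)
    (hkC1 : ContDiffOn ℝ 1 k (closure Ω))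
    (hμ : ∀ x ∈ frontier Ω, 0 ≤ μ x)
    (c : E2 → ℝ) (hc : ∀ x ∈ Ω, 0 ≤ c x)
    (g z : E2 → ℝ → ℝ) (hz : ContDiff ℝ (⊤ : ℕ∞) (Function.uncurry z))
    (hsol : IsDirectSolution Ω T k μ c g z)
    (hg : ∀ x ∈ Ω, ∀ t : ℝ, 0 ≤ t → t ≤ T → 0 ≤ g x t) :
    ∀ x ∈ Ω, ∀ t : ℝ, 0 ≤ t → t ≤ T → 0 ≤ z x t := by
  apply aux_max Ω hΩo hΩb hΩconv T k μ k₁ k₂ hk₁ hkbd hkC1 hμ c hc z hz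
  · intro x hx t h1 h2
    rw [hsol.pde x hx t h1 h2]
    exact hg x hx t h1.le h2
  · intro x hx; rw [hsol.ic x hx]
  · intro x hx ν hν hn t h1 h2
    rw [hsol.robin x hx ν hν hn t h1 h2]

lemma aux_mono (Ω : Set E2) (hΩo : IsOpen Ω) (hΩb : Bornology.IsBounded Ω) (hΩconv : Convex ℝ Ω)
    (T : ℝ)
    (k μ : E2 → ℝ) (k₁ k₂ : ℝ) (hk₁ : 0 < k₁)
    (hkbd : ∀ x ∈ closure Ω, k₁ ≤ k x ∧ k x ≤ k₂)
    (hkC1 : ContDiffOn ℝ 1 k (closure Ω))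
    (hμ : ∀ x ∈ frontier Ω, 0 ≤ μ x)
    (c : E2 → ℝ) (hc : ∀ x ∈ Ω, 0 ≤ c x)
    (g z : E2 → ℝ → ℝ) (hz : ContDiff ℝ (⊤ : ℕ∞) (Function.uncurry z))
    (hsol : IsDirectSolution Ω T k μ c g z)
    (hg : ∀ x ∈ Ω, ∀ t : ℝ, 0 ≤ t → t ≤ T → 0 ≤ g x t)
    (hgm : ∀ x ∈ Ω, ∀ s t : ℝ, 0 ≤ s → s ≤ t → t ≤ T → g x s ≤ g x t) :
    ∀ x ∈ Ω, ∀ s t : ℝ, 0 ≤ s → s ≤ t → t ≤ T → z x s ≤ z x t := by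
  intro x hx s t hs hst htT
  have hkd : ∀ x ∈ Ω, DifferentiableAt ℝ k x := fun x hx =>
    (hkC1.differentiableOn (by norm_num)).differentiableAt
      (Filter.mem_of_superset (hΩo.mem_nhds hx) subset_closure)
  obtain ⟨h, rfl⟩ : ∃ h, t = s + h := ⟨t - s, by ring⟩
  have hh : 0 ≤ h := by linarith
  have hpos := aux_sol Ω hΩo hΩb hΩconv T k μ k₁ k₂ hk₁ hkbd hkC1 hμ c hc g z hz hsol hg
  have hsm : ContDiff ℝ (⊤ : ℕ∞) (Function.uncurry fun x t => z x (t + h) - z x t) := by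
    have h1 : ContDiff ℝ (⊤ : ℕ∞) (fun q : E2 × ℝ => (q.1, q.2 + h)) := by fun_prop
    exact (hz.comp h1).sub hz
  have main := aux_max Ω hΩo hΩb hΩconv (T - h) k μ k₁ k₂ hk₁ hkbd hkC1 hμ c hc
    (fun x t => z x (t + h) - z x t) hsm ?_ ?_ ?_ x hx s hs (by linarith)
  · simpa using main
  · intro x hx t h1 h2
    have e1 := hsol.pde x hx t h1 (by linarith)
    have e2 := hsol.pde x hx (t + h) (by linarith) (by linarith)
    have e3 := hgm x hx t (t + h) h1.le (by linarith) (by linarith)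
    have hd := aux_slice' hz x
    have hd' : DifferentiableAt ℝ (fun t => z x (t + h)) t :=
      DifferentiableAt.comp t (hd (t + h)) (by fun_prop)
    rw [aux_ell_sub (hkd x hx) (aux_slice hz _) (aux_slice hz _), deriv_fun_sub hd' (hd t),
      deriv_comp_add_const]
    linarith
  · intro x hx
    have := hpos x hx h hh (by linarith)
    simpa [hsol.ic x hx] using this
  · intro x hx ν hν hn t h1 h2
    have e1 := hsol.robin x hx ν hν hn t h1 (by linarith)
    have e2 := hsol.robin x hx ν hν hn (t + h) (by linarith) (by linarith)
    rw [aux_fderiv_sub (aux_slice hz _) (aux_slice hz _)]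
    linarith

lemma aux_sub_sol (Ω : Set E2) (hΩo : IsOpen Ω) (T : ℝ) (k μ : E2 → ℝ)
    (hkC1 : ContDiffOn ℝ 1 k (closure Ω)) (c c' : E2 → ℝ) (f u u' : E2 → ℝ → ℝ)
    (hu : ContDiff ℝ (⊤ : ℕ∞) (Function.uncurry u))
    (hu' : ContDiff ℝ (⊤ : ℕ∞) (Function.uncurry u'))
    (h : IsDirectSolution Ω T k μ c f u) (h' : IsDirectSolution Ω T k μ c' f u') :
    IsDirectSolution Ω T k μ c (fun x t => (c' x - c x) * u' x t) (fun x t => u x t - u' x t) := by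
  have hkd : ∀ x ∈ Ω, DifferentiableAt ℝ k x := fun x hx =>
    (hkC1.differentiableOn (by norm_num)).differentiableAt
      (Filter.mem_of_superset (hΩo.mem_nhds hx) subset_closure)
  constructor
  · intro x hx t h1 h2
    have e1 := h.pde x hx t h1 h2
    have e2 := h'.pde x hx t h1 h2
    rw [aux_ell_sub (hkd x hx) (aux_slice hu _) (aux_slice hu' _),
      deriv_fun_sub (aux_slice' hu x t) (aux_slice' hu' x t)]
    linarith
  · intro x hx
    simp [h.ic x hx, h'.ic x hx]
  · intro x hx ν hν hn t h1 h2
    have e1 := h.robin x hx ν hν hn t h1 h2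
    have e2 := h'.robin x hx ν hν hn t h1 h2
    rw [aux_fderiv_sub (aux_slice hu _) (aux_slice hu' _)]
    linarith

/-- for the iterative process started from the initial approximation (16),
`w¹ = u¹ - u⁰ ≥ 0` on `Ω × (0,T]` and `ξ¹ = c¹ - c⁰ ≤ 0` on `Ω`. -/
theorem first_step_monotone
    (Ω : Set E2) (hΩo : IsOpen Ω) (hΩb : Bornology.IsBounded Ω) (hΩconv : Convex ℝ Ω)
    (T : ℝ) (hT : 0 < T)
    (k μ : E2 → ℝ) (k₁ k₂ : ℝ) (hk₁ : 0 < k₁)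
    (hkbd : ∀ x ∈ closure Ω, k₁ ≤ k x ∧ k x ≤ k₂)
    (hkC1 : ContDiffOn ℝ 1 k (closure Ω))
    (hμ : ∀ x ∈ frontier Ω, 0 ≤ μ x)
    (f : E2 → ℝ → ℝ) (hf : ContDiff ℝ (⊤ : ℕ∞) (Function.uncurry f))
    (c : E2 → ℝ) (hc : ∀ x ∈ Ω, 0 ≤ c x)
    (u : E2 → ℝ → ℝ) (hureg : ContDiff ℝ (⊤ : ℕ∞) (Function.uncurry u))
    (hu : IsDirectSolution Ω T k μ c f u)
    (hf0 : ∀ x ∈ Ω, f x 0 = 0)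
    (hft : ∀ x ∈ Ω, ∀ t : ℝ, 0 ≤ t → t ≤ T → 0 < deriv (f x) t)
    (ψ : E2 → ℝ) (hψdef : ∀ x, ψ x = u x T) (hψpos : ∀ x ∈ Ω, 0 < ψ x)
    (c0 : E2 → ℝ) (hc0 : ∀ x ∈ Ω, c0 x * ψ x = - ellOp k ψ x + f x T)
    (u0 : E2 → ℝ → ℝ) (hu0reg : ContDiff ℝ (⊤ : ℕ∞) (Function.uncurry u0))
    (hu0 : IsDirectSolution Ω T k μ c0 f u0)
    (c1 : E2 → ℝ)
    (hc1 : ∀ x ∈ Ω, c1 x * ψ x = - deriv (u0 x) T - ellOp k ψ x + f x T)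
    (u1 : E2 → ℝ → ℝ) (hu1reg : ContDiff ℝ (⊤ : ℕ∞) (Function.uncurry u1))
    (hu1 : IsDirectSolution Ω T k μ c1 f u1) :
    (∀ x ∈ Ω, ∀ t : ℝ, 0 < t → t ≤ T → 0 ≤ u1 x t - u0 x t) ∧
      (∀ x ∈ Ω, c1 x - c0 x ≤ 0) := by
  have hψ : ψ = fun y => u y T := funext hψdef
  have hsolve := aux_sol Ω hΩo hΩb hΩconv T k μ k₁ k₂ hk₁ hkbd hkC1 hμ
  have hmono := aux_mono Ω hΩo hΩb hΩconv T k μ k₁ k₂ hk₁ hkbd hkC1 hμ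
  have hfm : ∀ x ∈ Ω, ∀ s t : ℝ, 0 ≤ s → s ≤ t → t ≤ T → f x s ≤ f x t := by
    intro x hx s t hs hst htT
    have hd := aux_slice' hf x
    have := monotoneOn_of_deriv_nonneg (convex_Icc 0 T) hd.continuous.continuousOn
      hd.differentiableOn (fun r hr => by
        rw [interior_Icc] at hr
        exact (hft x hx r hr.1.le hr.2.le).le)
    exact this ⟨hs, hst.trans htT⟩ ⟨hs.trans hst, htT⟩ hst
  have hfp : ∀ x ∈ Ω, ∀ t : ℝ, 0 ≤ t → t ≤ T → 0 ≤ f x t := by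
    intro x hx t h1 h2
    rw [← hf0 x hx]
    exact hfm x hx 0 t le_rfl h1 h2
  have hdT : ∀ z : E2 → ℝ → ℝ, ContDiff ℝ (⊤ : ℕ∞) (Function.uncurry z) →
      (∀ x ∈ Ω, ∀ s t : ℝ, 0 ≤ s → s ≤ t → t ≤ T → z x s ≤ z x t) →
      ∀ x ∈ Ω, 0 ≤ deriv (z x) T := fun z hz hm x hx =>
    aux_deriv_nonneg (aux_slice' hz x T) hT (fun s h1 h2 => hm x hx s T h1 h2.le le_rfl)
  -- the exact solution increases in time, so `c ≤ c0`
  have hut := hdT u hureg (hmono c hc f u hureg hu hfp hfm)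
  have hcc0 : ∀ x ∈ Ω, c x ≤ c0 x := by
    intro x hx
    have e1 := hu.pde x hx T hT le_rfl
    have e2 := hc0 x hx
    rw [← hψ, ← hψdef] at e1
    refine le_of_mul_le_mul_right ?_ (hψpos x hx)
    linarith [hut x hx]
  have hc0p : ∀ x ∈ Ω, 0 ≤ c0 x := fun x hx => (hc x hx).trans (hcc0 x hx)
  have hu0p := hsolve c0 hc0p f u0 hu0reg hu0 hfp
  have hu0m := hmono c0 hc0p f u0 hu0reg hu0 hfp hfm
  have hu0t := hdT u0 hu0reg hu0m
  have hc10 : ∀ x ∈ Ω, c1 x ≤ c0 x := by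
    intro x hx
    refine le_of_mul_le_mul_right ?_ (hψpos x hx)
    linarith [hu0t x hx, hc0 x hx, hc1 x hx]
  -- the difference `u - u0` increases in time, so `c ≤ c1`
  have hz := aux_sub_sol Ω hΩo T k μ hkC1 c c0 f u u0 hureg hu0reg hu hu0
  have hzt := hdT (fun x t => u x t - u0 x t) (hureg.sub hu0reg)
    (hmono c hc _ _ (hureg.sub hu0reg) hz
      (fun x hx t h1 h2 => mul_nonneg (sub_nonneg.mpr (hcc0 x hx)) (hu0p x hx t h1 h2))
      (fun x hx s t h1 h2 h3 => mul_le_mul_of_nonneg_left (hu0m x hx s t h1 h2 h3)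
        (sub_nonneg.mpr (hcc0 x hx))))
  have hc1p : ∀ x ∈ Ω, 0 ≤ c1 x := by
    intro x hx
    refine (hc x hx).trans (le_of_mul_le_mul_right ?_ (hψpos x hx))
    have e1 := hu.pde x hx T hT le_rfl
    have e2 := hzt x hx
    rw [deriv_fun_sub (aux_slice' hureg x T) (aux_slice' hu0reg x T)] at e2
    rw [← hψ, ← hψdef] at e1
    linarith [hc1 x hx]
  have hw := aux_sub_sol Ω hΩo T k μ hkC1 c1 c0 f u1 u0 hu1reg hu0reg hu1 hu0
  have hwp := hsolve c1 hc1p _ (fun x t => u1 x t - u0 x t) (hu1reg.sub hu0reg) hw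
    (fun x hx t h1 h2 => mul_nonneg (sub_nonneg.mpr (hc10 x hx)) (hu0p x hx t h1 h2))
  exact ⟨fun x hx t h1 h2 => hwp x hx t h1.le h2, fun x hx => sub_nonpos.mpr (hc10 x hx)⟩

end
end
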